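/- Let (X,T) be a nonautonomous dynamical system, Z ⊂ X_0, and f = (f_k) an equicontinuous sequence of continuous real-valued potentials. Then Q^B(T,f,Z,ε) converges as ε → 0 and P^B(T,f,Z) = lim_{ε→0} Q^B(T,f,Z,ε). -/

import Mathlib

open Filter MeasureTheory Set
open scoped ENNReal Topology

namespace NDS

variable {X : ℕ → Type*}

/-- Iterates `T^j : X 0 → X j` of a nonautonomous dynamical system `T`. -/
def iter (T : ∀ k, X k → X (k + 1)) : ∀ j, X 0 → X j
  | 0 => fun x => x
  | j + 1 => fun x => T j (iter T j x)

/-- The Birkhoff-type sum `S_n^T f (x) = ∑_{j<n} f_j (T^j x)`. -/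
def birk (T : ∀ k, X k → X (k + 1)) (f : ∀ k, X k → ℝ) (n : ℕ) (x : X 0) : ℝ :=
  ∑ j ∈ Finset.range n, f j (iter T j x)

/-- The uniform norm `‖f‖ = sup_k sup_x |f_k x|` of a sequence of potentials. -/
noncomputable def fnorm (f : ∀ k, X k → ℝ) : ℝ :=
  ⨆ k : ℕ, ⨆ x : X k, |f k x|

/-- `log : ℝ≥0∞ → EReal` with the conventions `log 0 = -∞`, `log ∞ = ∞`. -/
noncomputable def elog (x : ℝ≥0∞) : EReal :=
  if x = 0 then ⊥ else if x = ⊤ then ⊤ else ((Real.log x.toReal : ℝ) : EReal)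

/-- The nonnegative part of an extended real, as an element of `ℝ≥0∞`. -/
noncomputable def toENN (x : EReal) : ℝ≥0∞ :=
  if x = ⊤ then ⊤ else ENNReal.ofReal x.toReal

/-- The canonical map `ℝ≥0∞ → EReal`. -/
noncomputable def ofENN (x : ℝ≥0∞) : EReal :=
  if x = ⊤ then ⊤ else ((x.toReal : ℝ) : EReal)

/-- The integral of an extended-real-valued function: the difference of the lower
integrals of its positive and negative parts. -/
noncomputable def eInt {α : Type*} [MeasurableSpace α] (μ : Measure α) (g : α → EReal) : EReal :=
  ofENN (∫⁻ x, toENN (g x) ∂μ) - ofENN (∫⁻ x, toENN (-g x) ∂μ)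

section Metric

variable [∀ k, MetricSpace (X k)]

/-- The open Bowen ball `B_n^T(x,ε)`. -/
def bowenBall (T : ∀ k, X k → X (k + 1)) (n : ℕ) (ε : ℝ) (x : X 0) : Set (X 0) :=
  {y | ∀ j < n, dist (iter T j x) (iter T j y) < ε}

/-- The closed Bowen ball `B̄_n^T(x,ε)`. -/
def bowenClosedBall (T : ∀ k, X k → X (k + 1)) (n : ℕ) (ε : ℝ) (x : X 0) : Set (X 0) :=
  {y | ∀ j < n, dist (iter T j x) (iter T j y) ≤ ε}

/-- Equicontinuity of a sequence of potentials `f = (f_k)`. -/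
def EquicontPotential (f : ∀ k, X k → ℝ) : Prop :=
  ∀ ε : ℝ, 0 < ε → ∃ δ : ℝ, 0 < δ ∧ ∀ k, ∀ x y : X k, dist x y < δ → |f k x - f k y| < ε

/-- The supremum of the Birkhoff sum `S_n^T f` over a subset `A` of `X 0`. -/
noncomputable def supBirk (T : ∀ k, X k → X (k + 1)) (f : ∀ k, X k → ℝ) (n : ℕ)
    (A : Set (X 0)) : ℝ :=
  ⨆ y : A, birk T f n (y : X 0)

/-- Measure-theoretic lower local pressure `P̲_μ(T,f,x)`. -/
noncomputable def localLowerPres [MeasurableSpace (X 0)] (μ : Measure (X 0))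
    (T : ∀ k, X k → X (k + 1)) (f : ∀ k, X k → ℝ) (x : X 0) : EReal :=
  ⨆ (ε : ℝ) (_ : 0 < ε),
    liminf (fun n : ℕ =>
      (((n : ℝ)⁻¹ : ℝ) : EReal) *
        (-(elog (μ (bowenBall T n ε x))) + ((birk T f n x : ℝ) : EReal))) atTop

/-- Measure-theoretic upper local pressure `P̄_μ(T,f,x)`. -/
noncomputable def localUpperPres [MeasurableSpace (X 0)] (μ : Measure (X 0))
    (T : ∀ k, X k → X (k + 1)) (f : ∀ k, X k → ℝ) (x : X 0) : EReal :=
  ⨆ (ε : ℝ) (_ : 0 < ε),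
    limsup (fun n : ℕ =>
      (((n : ℝ)⁻¹ : ℝ) : EReal) *
        (-(elog (μ (bowenBall T n ε x))) + ((birk T f n x : ℝ) : EReal))) atTop

/-- Measure-theoretic lower local entropy `h̲_μ(T,x)`. -/
noncomputable def localLowerEnt [MeasurableSpace (X 0)] (μ : Measure (X 0))
    (T : ∀ k, X k → X (k + 1)) (x : X 0) : EReal :=
  ⨆ (ε : ℝ) (_ : 0 < ε),
    liminf (fun n : ℕ =>
      (((n : ℝ)⁻¹ : ℝ) : EReal) * (-(elog (μ (bowenBall T n ε x))))) atTop

/-- Measure-theoretic upper local entropy `h̄_μ(T,x)`. -/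
noncomputable def localUpperEnt [MeasurableSpace (X 0)] (μ : Measure (X 0))
    (T : ∀ k, X k → X (k + 1)) (x : X 0) : EReal :=
  ⨆ (ε : ℝ) (_ : 0 < ε),
    limsup (fun n : ℕ =>
      (((n : ℝ)⁻¹ : ℝ) : EReal) * (-(elog (μ (bowenBall T n ε x))))) atTop

/-- Measure-theoretic lower pressure `P̲_μ(T,f) = ∫ P̲_μ(T,f,x) dμ(x)`. -/
noncomputable def lowerPres [MeasurableSpace (X 0)] (μ : Measure (X 0))
    (T : ∀ k, X k → X (k + 1)) (f : ∀ k, X k → ℝ) : EReal :=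
  eInt μ (fun x => localLowerPres μ T f x)

/-- Measure-theoretic upper pressure `P̄_μ(T,f) = ∫ P̄_μ(T,f,x) dμ(x)`. -/
noncomputable def upperPres [MeasurableSpace (X 0)] (μ : Measure (X 0))
    (T : ∀ k, X k → X (k + 1)) (f : ∀ k, X k → ℝ) : EReal :=
  eInt μ (fun x => localUpperPres μ T f x)

/-- Measure-theoretic lower entropy `h̲_μ(T) = ∫ h̲_μ(T,x) dμ(x)`. -/
noncomputable def lowerEnt [MeasurableSpace (X 0)] (μ : Measure (X 0))
    (T : ∀ k, X k → X (k + 1)) : EReal :=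
  eInt μ (fun x => localLowerEnt μ T x)

/-- Measure-theoretic upper entropy `h̄_μ(T) = ∫ h̄_μ(T,x) dμ(x)`. -/
noncomputable def upperEnt [MeasurableSpace (X 0)] (μ : Measure (X 0))
    (T : ∀ k, X k → X (k + 1)) : EReal :=
  eInt μ (fun x => localUpperEnt μ T x)

/-- The Bowen premeasure `M^s_{N,ε}(T,f,Z)`: the infimum of
`∑ exp(-n_i s + S_{n_i}^T f(x_i))` over all countable `(N,ε)`-covers of `Z` by open
Bowen balls `B_{n_i}^T(x_i,ε)` with `n_i ≥ N`. -/
noncomputable def bowenPre (T : ∀ k, X k → X (k + 1)) (f : ∀ k, X k → ℝ)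
    (s : ℝ) (N : ℕ) (ε : ℝ) (Z : Set (X 0)) : ℝ≥0∞ :=
  ⨅ (D : Set (X 0 × ℕ)) (_ : D.Countable) (_ : ∀ p ∈ D, N ≤ p.2)
      (_ : Z ⊆ ⋃ p ∈ D, bowenBall T p.2 ε p.1),
    ∑' p : D, ENNReal.ofReal (Real.exp (-(p.1.2 : ℝ) * s + birk T f p.1.2 p.1.1))

/-- `M^s_ε(T,f,Z) = lim_{N→∞} M^s_{N,ε}(T,f,Z)` (an increasing limit). -/
noncomputable def bowenPreLim (T : ∀ k, X k → X (k + 1)) (f : ∀ k, X k → ℝ)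
    (s : ℝ) (ε : ℝ) (Z : Set (X 0)) : ℝ≥0∞ :=
  ⨆ N : ℕ, bowenPre T f s N ε Z

/-- The critical value `P^B(T,f,Z,ε) = inf {s : M^s_ε(T,f,Z) = 0}`. -/
noncomputable def bowenCrit (T : ∀ k, X k → X (k + 1)) (f : ∀ k, X k → ℝ)
    (ε : ℝ) (Z : Set (X 0)) : EReal :=
  ⨅ (s : ℝ) (_ : bowenPreLim T f s ε Z = 0), (s : EReal)

/-- The Bowen (Pesin–Pitskel') topological pressure
`P^B(T,f,Z) = lim_{ε→0} P^B(T,f,Z,ε)` (an increasing limit as `ε ↓ 0`). -/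
noncomputable def bowenP (T : ∀ k, X k → X (k + 1)) (f : ∀ k, X k → ℝ)
    (Z : Set (X 0)) : EReal :=
  ⨆ (ε : ℝ) (_ : 0 < ε), bowenCrit T f ε Z

/-- The Bowen topological entropy `h^B(T,Z) = P^B(T,0,Z)`. -/
noncomputable def bowenEnt (T : ∀ k, X k → X (k + 1)) (Z : Set (X 0)) : EReal :=
  bowenP T (fun k => fun _ : X k => (0 : ℝ)) Z

/-- The premeasure `N^s_{N,ε}(T,f,Z)` using suprema of Birkhoff sums over the balls. -/
noncomputable def nBowenPre (T : ∀ k, X k → X (k + 1)) (f : ∀ k, X k → ℝ)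
    (s : ℝ) (N : ℕ) (ε : ℝ) (Z : Set (X 0)) : ℝ≥0∞ :=
  ⨅ (D : Set (X 0 × ℕ)) (_ : D.Countable) (_ : ∀ p ∈ D, N ≤ p.2)
      (_ : Z ⊆ ⋃ p ∈ D, bowenBall T p.2 ε p.1),
    ∑' p : D, ENNReal.ofReal
      (Real.exp (-(p.1.2 : ℝ) * s + supBirk T f p.1.2 (bowenBall T p.1.2 ε p.1.1)))

/-- `N^s_ε(T,f,Z) = lim_{N→∞} N^s_{N,ε}(T,f,Z)`. -/
noncomputable def nBowenPreLim (T : ∀ k, X k → X (k + 1)) (f : ∀ k, X k → ℝ)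
    (s : ℝ) (ε : ℝ) (Z : Set (X 0)) : ℝ≥0∞ :=
  ⨆ N : ℕ, nBowenPre T f s N ε Z

/-- The critical value `Q^B(T,f,Z,ε) = inf {s : N^s_ε(T,f,Z) = 0}`. -/
noncomputable def nBowenCrit (T : ∀ k, X k → X (k + 1)) (f : ∀ k, X k → ℝ)
    (ε : ℝ) (Z : Set (X 0)) : EReal :=
  ⨅ (s : ℝ) (_ : nBowenPreLim T f s ε Z = 0), (s : EReal)

/-- The weighted Bowen premeasure `W^s_{N,ε}(T,f,g)`: the infimum of
`∑ c_i exp(-n_i s + sup_{B_{n_i}^T(x_i,ε)} S_{n_i}^T f)` over all countable families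
`{(B_{n_i}^T(x_i,ε), c_i)}` with `0 < c_i`, `n_i ≥ N` and `∑ c_i χ_{B_i} ≥ g`. -/
noncomputable def wBowenPre (T : ∀ k, X k → X (k + 1)) (f : ∀ k, X k → ℝ)
    (s : ℝ) (N : ℕ) (ε : ℝ) (g : X 0 → ℝ) : ℝ≥0∞ :=
  ⨅ (D : Set ((X 0 × ℕ) × ℝ)) (_ : D.Countable)
      (_ : ∀ p ∈ D, N ≤ p.1.2 ∧ 0 < p.2)
      (_ : ∀ x : X 0, ENNReal.ofReal (g x) ≤
        ∑' p : D, (bowenBall T p.1.1.2 ε p.1.1.1).indicator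
          (fun _ => ENNReal.ofReal p.1.2) x),
    ∑' p : D, ENNReal.ofReal p.1.2 *
      ENNReal.ofReal
        (Real.exp (-(p.1.1.2 : ℝ) * s + supBirk T f p.1.1.2 (bowenBall T p.1.1.2 ε p.1.1.1)))

/-- `D` is a countable `(N,ε)`-packing of `Z`: the closed Bowen balls
`B̄_{n}^T(x,ε)`, `(x,n) ∈ D`, are pairwise disjoint with centers in `Z` and orders `≥ N`. -/
def IsPacking (T : ∀ k, X k → X (k + 1)) (N : ℕ) (ε : ℝ) (Z : Set (X 0))
    (D : Set (X 0 × ℕ)) : Prop :=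
  D.Countable ∧ (∀ p ∈ D, p.1 ∈ Z ∧ N ≤ p.2) ∧
    ∀ p ∈ D, ∀ q ∈ D, p ≠ q →
      Disjoint (bowenClosedBall T p.2 ε p.1) (bowenClosedBall T q.2 ε q.1)

/-- The packing premeasure `P^s_{N,ε}(T,f,Z)`: the supremum of
`∑ exp(-n_i s + S_{n_i}^T f(x_i))` over all countable `(N,ε)`-packings of `Z`. -/
noncomputable def packPre (T : ∀ k, X k → X (k + 1)) (f : ∀ k, X k → ℝ)
    (s : ℝ) (N : ℕ) (ε : ℝ) (Z : Set (X 0)) : ℝ≥0∞ :=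
  ⨆ (D : Set (X 0 × ℕ)) (_ : IsPacking T N ε Z D),
    ∑' p : D, ENNReal.ofReal (Real.exp (-(p.1.2 : ℝ) * s + birk T f p.1.2 p.1.1))

/-- `P^s_{∞,ε}(T,f,Z) = lim_{N→∞} P^s_{N,ε}(T,f,Z)` (a decreasing limit). -/
noncomputable def packPreInf (T : ∀ k, X k → X (k + 1)) (f : ∀ k, X k → ℝ)
    (s : ℝ) (ε : ℝ) (Z : Set (X 0)) : ℝ≥0∞ :=
  ⨅ N : ℕ, packPre T f s N ε Z

/-- The packing measure-like quantity
`P^s_ε(T,f,Z) = inf { ∑_i P^s_{∞,ε}(T,f,Z_i) : Z ⊆ ⋃_i Z_i }`. -/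
noncomputable def packMeasure (T : ∀ k, X k → X (k + 1)) (f : ∀ k, X k → ℝ)
    (s : ℝ) (ε : ℝ) (Z : Set (X 0)) : ℝ≥0∞ :=
  ⨅ (Zs : ℕ → Set (X 0)) (_ : Z ⊆ ⋃ i, Zs i), ∑' i, packPreInf T f s ε (Zs i)

/-- The critical value `P^P(T,f,Z,ε) = inf {s : P^s_ε(T,f,Z) = 0}`. -/
noncomputable def packCrit (T : ∀ k, X k → X (k + 1)) (f : ∀ k, X k → ℝ)
    (ε : ℝ) (Z : Set (X 0)) : EReal :=
  ⨅ (s : ℝ) (_ : packMeasure T f s ε Z = 0), (s : EReal)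

/-- The packing topological pressure `P^P(T,f,Z) = lim_{ε→0} P^P(T,f,Z,ε)`. -/
noncomputable def packP (T : ∀ k, X k → X (k + 1)) (f : ∀ k, X k → ℝ)
    (Z : Set (X 0)) : EReal :=
  ⨆ (ε : ℝ) (_ : 0 < ε), packCrit T f ε Z

/-- The packing topological entropy `h^P(T,Z) = P^P(T,0,Z)`. -/
noncomputable def packEnt (T : ∀ k, X k → X (k + 1)) (Z : Set (X 0)) : EReal :=
  packP T (fun k => fun _ : X k => (0 : ℝ)) Z

/-- The packing premeasure `Q^s_{N,ε}(T,f,Z)` using suprema of Birkhoff sums over the balls. -/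
noncomputable def qPackPre (T : ∀ k, X k → X (k + 1)) (f : ∀ k, X k → ℝ)
    (s : ℝ) (N : ℕ) (ε : ℝ) (Z : Set (X 0)) : ℝ≥0∞ :=
  ⨆ (D : Set (X 0 × ℕ)) (_ : IsPacking T N ε Z D),
    ∑' p : D, ENNReal.ofReal
      (Real.exp (-(p.1.2 : ℝ) * s + supBirk T f p.1.2 (bowenClosedBall T p.1.2 ε p.1.1)))

/-- `Q^s_{∞,ε}(T,f,Z) = lim_{N→∞} Q^s_{N,ε}(T,f,Z)`. -/
noncomputable def qPackPreInf (T : ∀ k, X k → X (k + 1)) (f : ∀ k, X k → ℝ)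
    (s : ℝ) (ε : ℝ) (Z : Set (X 0)) : ℝ≥0∞ :=
  ⨅ N : ℕ, qPackPre T f s N ε Z

/-- `Q^s_ε(T,f,Z) = inf { ∑_i Q^s_{∞,ε}(T,f,Z_i) : Z ⊆ ⋃_i Z_i }`. -/
noncomputable def qPackMeasure (T : ∀ k, X k → X (k + 1)) (f : ∀ k, X k → ℝ)
    (s : ℝ) (ε : ℝ) (Z : Set (X 0)) : ℝ≥0∞ :=
  ⨅ (Zs : ℕ → Set (X 0)) (_ : Z ⊆ ⋃ i, Zs i), ∑' i, qPackPreInf T f s ε (Zs i)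

/-- The critical value `Q^P(T,f,Z,ε) = inf {s : Q^s_ε(T,f,Z) = 0}`. -/
noncomputable def qPackCrit (T : ∀ k, X k → X (k + 1)) (f : ∀ k, X k → ℝ)
    (ε : ℝ) (Z : Set (X 0)) : EReal :=
  ⨅ (s : ℝ) (_ : qPackMeasure T f s ε Z = 0), (s : EReal)

end Metric

/-- The distance function of an explicitly given metric space structure. -/
def mdist {α : Type*} (m : MetricSpace α) (x y : α) : ℝ :=
  @dist α m.toPseudoMetricSpace.toDist x y

end NDS

namespace NDS

variable {X : ℕ → Type*} [∀ k, MetricSpace (X k)] {T : ∀ k, X k → X (k + 1)}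
  {f : ∀ k, X k → ℝ} {Z : Set (X 0)}

theorem bowenBall_mono (n : ℕ) {ε ε' : ℝ} (h : ε ≤ ε') (x : X 0) :
    bowenBall T n ε x ⊆ bowenBall T n ε' x :=
  fun _ hy j hj => (hy j hj).trans_le h

theorem mem_bowenBall_self (n : ℕ) {ε : ℝ} (hε : 0 < ε) (x : X 0) : x ∈ bowenBall T n ε x :=
  fun j _ => by simpa using hε

theorem birk_le_of_mem_bowenBall {ε α : ℝ}
    (h : ∀ k, ∀ x y : X k, dist x y < ε → |f k x - f k y| < α) {n : ℕ} {x y : X 0}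
    (hy : y ∈ bowenBall T n ε x) : birk T f n y ≤ birk T f n x + n * α := by
  have key : ∑ j ∈ Finset.range n, f j (iter T j y) ≤
      ∑ j ∈ Finset.range n, (f j (iter T j x) + α) := by
    refine Finset.sum_le_sum fun j hj => ?_
    have := (abs_lt.mp (h j _ _ (hy j (Finset.mem_range.mp hj)))).1
    linarith
  simpa [birk, Finset.sum_add_distrib] using key

theorem supBirk_bowenBall_le {ε α : ℝ} (hε : 0 < ε)
    (h : ∀ k, ∀ x y : X k, dist x y < ε → |f k x - f k y| < α) (n : ℕ) (x : X 0) :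
    supBirk T f n (bowenBall T n ε x) ≤ birk T f n x + n * α := by
  have : Nonempty (bowenBall T n ε x) := ⟨⟨x, mem_bowenBall_self n hε x⟩⟩
  exact ciSup_le fun y => birk_le_of_mem_bowenBall h y.2

theorem birk_le_supBirk_bowenBall {ε α : ℝ} (hε : 0 < ε)
    (h : ∀ k, ∀ x y : X k, dist x y < ε → |f k x - f k y| < α) (n : ℕ) (x : X 0) :
    birk T f n x ≤ supBirk T f n (bowenBall T n ε x) := by
  refine le_ciSup (f := fun y : bowenBall T n ε x => birk T f n (y : X 0))
    ⟨birk T f n x + n * α, ?_⟩ ⟨x, mem_bowenBall_self n hε x⟩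
  rintro _ ⟨y, rfl⟩
  exact birk_le_of_mem_bowenBall h y.2

theorem bowenPre_anti (s : ℝ) (N : ℕ) {ε ε' : ℝ} (h : ε ≤ ε') :
    bowenPre T f s N ε' Z ≤ bowenPre T f s N ε Z :=
  le_iInf fun D => le_iInf fun hc => le_iInf fun hN => le_iInf fun hZ =>
    iInf_le_of_le D <| iInf_le_of_le hc <| iInf_le_of_le hN <| iInf_le_of_le
      (hZ.trans (iUnion₂_mono fun p _ => bowenBall_mono p.2 h p.1)) le_rfl

theorem bowenCrit_anti {ε ε' : ℝ} (h : ε ≤ ε') :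
    bowenCrit T f ε' Z ≤ bowenCrit T f ε Z :=
  le_iInf₂ fun s hs => biInf_le (fun s : ℝ => (s : EReal)) <| show _ = 0 from le_antisymm
    ((iSup_mono fun N => bowenPre_anti s N h).trans hs.le) zero_le

theorem bowenPre_le_nBowenPre {ε α : ℝ} (hε : 0 < ε)
    (h : ∀ k, ∀ x y : X k, dist x y < ε → |f k x - f k y| < α) (s : ℝ) (N : ℕ) :
    bowenPre T f s N ε Z ≤ nBowenPre T f s N ε Z := by
  unfold bowenPre nBowenPre
  gcongr with D hc hN hZ p
  exact birk_le_supBirk_bowenBall hε h _ _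

theorem nBowenPre_add_le_bowenPre {ε α : ℝ} (hε : 0 < ε)
    (h : ∀ k, ∀ x y : X k, dist x y < ε → |f k x - f k y| < α) (s : ℝ) (N : ℕ) :
    nBowenPre T f (s + α) N ε Z ≤ bowenPre T f s N ε Z := by
  unfold bowenPre nBowenPre
  refine iInf_mono fun D => iInf_mono fun _ => iInf_mono fun _ => iInf_mono fun _ =>
    ENNReal.tsum_le_tsum fun p => ENNReal.ofReal_le_ofReal (Real.exp_le_exp.mpr ?_)
  have := supBirk_bowenBall_le (T := T) hε h p.1.2 p.1.1
  linarith

theorem bowenCrit_le_nBowenCrit {ε α : ℝ} (hε : 0 < ε)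
    (h : ∀ k, ∀ x y : X k, dist x y < ε → |f k x - f k y| < α) :
    bowenCrit T f ε Z ≤ nBowenCrit T f ε Z :=
  le_iInf₂ fun s hs => biInf_le (fun s : ℝ => (s : EReal)) <| show _ = 0 from le_antisymm
    ((iSup_mono fun N => bowenPre_le_nBowenPre hε h s N).trans hs.le) zero_le

theorem nBowenCrit_le_of_bowenCrit_lt {ε α q : ℝ} (hε : 0 < ε)
    (h : ∀ k, ∀ x y : X k, dist x y < ε → |f k x - f k y| < α)
    (hq : bowenCrit T f ε Z < q) : nBowenCrit T f ε Z ≤ ((q + α : ℝ) : EReal) := by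
  obtain ⟨s, hs⟩ := iInf_lt_iff.mp hq
  obtain ⟨hs0, hsq⟩ := iInf_lt_iff.mp hs
  refine (biInf_le (fun s : ℝ => (s : EReal)) <| show nBowenPreLim T f (s + α) ε Z = 0 from le_antisymm
    ((iSup_mono fun N => nBowenPre_add_le_bowenPre hε h s N).trans hs0.le) zero_le).trans ?_
  have := EReal.coe_lt_coe_iff.mp hsq
  exact EReal.coe_le_coe_iff.mpr (by linarith)

end NDS

open NDS in
/-- Equivalent definition of the Bowen pressure.
If `f` is equicontinuous then `Q^B(T,f,Z,ε)` converges as `ε → 0⁺` and its limit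
is the Bowen pressure `P^B(T,f,Z)`. -/
theorem stmt8 {X : ℕ → Type*} [∀ k, MetricSpace (X k)] [∀ k, CompactSpace (X k)]
    (T : ∀ k, X k → X (k + 1)) (hT : ∀ k, Continuous (T k))
    (f : ∀ k, X k → ℝ) (hf : ∀ k, Continuous (f k)) (hfe : EquicontPotential f)
    (Z : Set (X 0)) :
    Filter.Tendsto (fun ε : ℝ => nBowenCrit T f ε Z) (nhdsWithin 0 (Set.Ioi 0))
      (nhds (bowenP T f Z)) := by
  have ev : ∀ α : ℝ, 0 < α → ∀ᶠ ε in nhdsWithin (0 : ℝ) (Set.Ioi 0),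
      0 < ε ∧ ∀ k, ∀ x y : X k, dist x y < ε → |f k x - f k y| < α := by
    intro α hα
    obtain ⟨δ, hδ, hfδ⟩ := hfe α hα
    filter_upwards [Ioo_mem_nhdsGT hδ] with ε hε
    exact ⟨hε.1, fun k x y hxy => hfδ k x y (hxy.trans hε.2)⟩
  refine tendsto_order.mpr ⟨fun a ha => ?_, fun a ha => ?_⟩
  · obtain ⟨ε₀, hε₀⟩ := lt_iSup_iff.mp ha
    obtain ⟨hpos, hlt⟩ := lt_iSup_iff.mp hε₀
    filter_upwards [ev 1 one_pos, Ioo_mem_nhdsGT hpos] with ε hε hεε₀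
    exact hlt.trans_le ((bowenCrit_anti hεε₀.2.le).trans (bowenCrit_le_nBowenCrit hε.1 hε.2))
  · obtain ⟨r, hPr, hra⟩ := EReal.lt_iff_exists_real_btwn.mp ha
    obtain ⟨q, hPq, hqr⟩ := EReal.lt_iff_exists_real_btwn.mp hPr
    have hqr' : q < r := EReal.coe_lt_coe_iff.mp hqr
    filter_upwards [ev (r - q) (sub_pos.mpr hqr')] with ε hε
    have hcrit : bowenCrit T f ε Z < q :=
      (le_iSup₂ (f := fun (ε : ℝ) (_ : 0 < ε) => bowenCrit T f ε Z) ε hε.1).trans_lt hPq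
    have hle := nBowenCrit_le_of_bowenCrit_lt hε.1 hε.2 hcrit
    rw [add_sub_cancel] at hle
    exact hle.trans_lt hra
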